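/- There exists a Steiner system S(2,9,289); that is, there exists a finite type V with exactly 289 elements together with a family ℬ of 9-element subsets of V (blocks) such that every 2-element subset of V is contained in exactly one block of ℬ. -/

import Mathlib

/-- The translates of the base blocks of a `(G, k, 1)` difference family. -/
def translates {G ι : Type*} [AddCommGroup G] [Fintype G] [DecidableEq G] [Fintype ι]
    (D : ι → Finset G) : Finset (Finset G) :=
  Finset.univ.image fun t : ι × G => (D t.1).image (· + t.2)

theorem mem_translates {G ι : Type*} [AddCommGroup G] [Fintype G] [DecidableEq G] [Fintype ι]
    {D : ι → Finset G} {B : Finset G} :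
    B ∈ translates D ↔ ∃ i g, (D i).image (· + g) = B := by
  simp [translates]

theorem card_of_mem_translates {G ι : Type*} [AddCommGroup G] [Fintype G] [DecidableEq G]
    [Fintype ι] {D : ι → Finset G} {k : ℕ} (hk : ∀ i, (D i).card = k) {B : Finset G}
    (hB : B ∈ translates D) : B.card = k := by
  obtain ⟨i, g, rfl⟩ := mem_translates.1 hB
  rw [Finset.card_image_of_injective _ (add_left_injective g), hk]

/-- If every nonzero element is exactly once a difference of two elements of the same base block,
then every pair of points lies in exactly one translate. -/
theorem existsUnique_mem_translates {G ι : Type*} [AddCommGroup G] [Fintype G] [DecidableEq G]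
    [Fintype ι] {D : ι → Finset G}
    (hD : ∀ d : G, d ≠ 0 → ∃! t : ι × G × G, t.2.1 ∈ D t.1 ∧ t.2.2 ∈ D t.1 ∧ t.2.1 - t.2.2 = d)
    (p : Finset G) (hp : p.card = 2) : ∃! B, B ∈ translates D ∧ p ⊆ B := by
  obtain ⟨x, y, hxy, rfl⟩ := Finset.card_eq_two.1 hp
  obtain ⟨⟨i, a, b⟩, ⟨ha, hb, hab⟩, huniq⟩ := hD (x - y) (sub_ne_zero.2 hxy)
  dsimp only at ha hb hab
  refine ⟨(D i).image (· + (x - a)), ⟨mem_translates.2 ⟨i, _, rfl⟩, ?_⟩, ?_⟩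
  · simp only [Finset.insert_subset_iff, Finset.singleton_subset_iff, Finset.mem_image]
    refine ⟨⟨a, ha, by abel⟩, ⟨b, hb, ?_⟩⟩
    calc b + (x - a) = x - (a - b) := by abel
      _ = y := by rw [hab]; abel
  · rintro B ⟨hB, hsub⟩
    obtain ⟨j, g, rfl⟩ := mem_translates.1 hB
    simp only [Finset.insert_subset_iff, Finset.singleton_subset_iff, Finset.mem_image] at hsub
    obtain ⟨⟨c, hc, rfl⟩, ⟨e, he, rfl⟩⟩ := hsub
    have h := huniq (j, c, e) ⟨hc, he, by simp⟩
    obtain ⟨rfl, rfl, rfl⟩ : j = i ∧ c = a ∧ e = b := by simpa using h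
    simp

/-- If every nonzero element of `G` is a difference of two elements of the same base block, and
there are only `|G| - 1` such differences in total, then each occurs exactly once. -/
theorem existsUnique_difference {G ι : Type*} [AddCommGroup G] [Fintype G] [DecidableEq G]
    [Fintype ι] [DecidableEq ι] {D : ι → Finset G}
    (hcard : ∑ i, (D i).offDiag.card = Fintype.card G - 1)
    (hD : ∀ d : G, d ≠ 0 → ∃ i, ∃ b ∈ D i, d + b ∈ D i) (d : G) (hd : d ≠ 0) :
    ∃! t : ι × G × G, t.2.1 ∈ D t.1 ∧ t.2.2 ∈ D t.1 ∧ t.2.1 - t.2.2 = d := by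
  let S : Finset (Σ _ : ι, G × G) := Finset.univ.sigma fun i => (D i).offDiag
  have hS : S.card = (Finset.univ.erase (0 : G)).card := by
    rw [Finset.card_sigma, hcard, Finset.card_erase_of_mem (Finset.mem_univ _), Finset.card_univ]
  have hmaps : ∀ t ∈ S, t.2.1 - t.2.2 ∈ Finset.univ.erase (0 : G) := by
    rintro ⟨i, a, b⟩ h
    simpa [S, sub_eq_zero] using (Finset.mem_offDiag.1 (Finset.mem_sigma.1 h).2).2.2
  have hsurj : ∀ d ∈ Finset.univ.erase (0 : G), ∃ t, ∃ _ : t ∈ S, t.2.1 - t.2.2 = d := by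
    intro d hd
    obtain ⟨i, b, hb, hdb⟩ := hD d (Finset.ne_of_mem_erase hd)
    exact ⟨⟨i, d + b, b⟩, by simpa [S, hb, hdb] using hd, by simp⟩
  have hinj := Finset.inj_on_of_surj_on_of_card_le
    (fun (t : Σ _ : ι, G × G) (_ : t ∈ S) => t.2.1 - t.2.2) hmaps hsurj hS.le
  obtain ⟨i, b, hb, hdb⟩ := hD d hd
  refine ⟨(i, d + b, b), ⟨hdb, hb, by simp⟩, ?_⟩
  rintro ⟨j, c, e⟩ ⟨hc, he, hce⟩
  dsimp only at hc he hce
  have hjS : ⟨j, c, e⟩ ∈ S := by simpa [S, hc, he, ← sub_eq_zero (a := c), hce] using hd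
  have hiS : ⟨i, d + b, b⟩ ∈ S := by simpa [S, hb, hdb] using hd
  have h := hinj hjS hiS (by simpa using hce)
  simpa using h

/-- Base blocks of a `(289, 9, 1)` difference family over `(ℤ/17)²`. Each is a union of three orbits
of the automorphism `(a, b) ↦ (-b, a - b)` of order three, listed row by row. -/
def baseBlock : Fin 4 → Finset (ZMod 17 × ZMod 17) :=
  ![{(1, 9), (8, 9), (8, 16),
     (1, 10), (7, 8), (9, 16),
     (2, 8), (9, 11), (6, 15)},
    {(0, 8), (9, 9), (8, 0),
     (3, 6), (11, 14), (3, 14),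
     (6, 5), (12, 1), (16, 11)},
    {(2, 4), (13, 15), (2, 15),
     (6, 2), (15, 4), (13, 11),
     (9, 2), (15, 7), (10, 8)},
    {(0, 2), (15, 15), (2, 0),
     (3, 13), (4, 7), (10, 14),
     (5, 10), (7, 12), (5, 12)}]

theorem card_baseBlock : ∀ i, (baseBlock i).card = 9 := by
  decide +kernel

theorem exists_difference_baseBlock :
    ∀ d : ZMod 17 × ZMod 17, d ≠ 0 → ∃ i, ∃ b ∈ baseBlock i, d + b ∈ baseBlock i := by
  decide +kernel

theorem stmt_1 :
    ∃ (V : Type) (_ : Fintype V), Fintype.card V = 289 ∧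
      ∃ ℬ : Finset (Finset V), (∀ B ∈ ℬ, B.card = 9) ∧
        ∀ p : Finset V, p.card = 2 → ∃! B, B ∈ ℬ ∧ p ⊆ B := by
  refine ⟨ZMod 17 × ZMod 17, inferInstance, by simp [ZMod.card], translates baseBlock,
    fun B hB => card_of_mem_translates card_baseBlock hB,
    existsUnique_mem_translates (existsUnique_difference ?_ exists_difference_baseBlock)⟩
  simp [Finset.offDiag_card, card_baseBlock, ZMod.card]
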